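/- There are absolute constants a and A such that for every integer k ≥ 2, every k-Fourier-sparse signal g(t) = ∑_{j=1}^k v_j·exp(2πi·f_j·t), and every θ > 0, there exist an integer d ≤ a·k²·log k and complex coefficients α₁, …, α_d with |α_j| ≤ A for all j, such that for every x ∈ ℝ (not necessarily in [−1,1]), g(x) = ∑_{j=1}^d α_j · g(x − j·θ). -/

import Mathlib

open Real

/-- The coefficients of `X ^ n` in the Newton basis `∏ l ∈ range i, (X - z l)`. -/
noncomputable def newtonCoeff (z : ℕ → ℂ) : ℕ → ℕ → ℂ
  | 0, 0 => 1
  | 0, _ + 1 => 0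
  | n + 1, 0 => z 0 * newtonCoeff z n 0
  | n + 1, i + 1 => newtonCoeff z n i + z (i + 1) * newtonCoeff z n (i + 1)

lemma norm_newtonCoeff_le {z : ℕ → ℂ} (hz : ∀ i, ‖z i‖ ≤ 1) (n i : ℕ) :
    ‖newtonCoeff z n i‖ ≤ n.choose i := by
  induction n generalizing i with
  | zero => cases i <;> simp [newtonCoeff]
  | succ n ih =>
    have hmul : ∀ i, ‖z i * newtonCoeff z n i‖ ≤ n.choose i := fun i => by
      rw [norm_mul]
      exact (mul_le_of_le_one_left (norm_nonneg _) (hz i)).trans (ih i)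
    cases i with
    | zero => simpa [newtonCoeff] using hmul 0
    | succ i =>
      rw [newtonCoeff, Nat.choose_succ_succ, Nat.cast_add]
      exact (norm_add_le _ _).trans (add_le_add (ih i) (hmul (i + 1)))

/-- Newton expansion of a power at one of the first `k` nodes. -/
lemma pow_eq_sum_newtonCoeff (z : ℕ → ℂ) {j k : ℕ} (hj : j < k) (n : ℕ) :
    z j ^ n = ∑ i ∈ Finset.range k,
      newtonCoeff z n i * ∏ l ∈ Finset.range i, (z j - z l) := by
  obtain ⟨k, rfl⟩ : ∃ m, k = m + 1 := ⟨k - 1, by omega⟩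
  induction n with
  | zero => simp [Finset.sum_range_succ', newtonCoeff]
  | succ n ih =>
    have hzero : ∏ l ∈ Finset.range (k + 1), (z j - z l) = 0 :=
      Finset.prod_eq_zero (Finset.mem_range.2 hj) (sub_self _)
    have hshift : ∑ i ∈ Finset.range (k + 1), newtonCoeff z n i *
          ∏ l ∈ Finset.range (i + 1), (z j - z l) =
        ∑ i ∈ Finset.range k, newtonCoeff z n i *
          ∏ l ∈ Finset.range (i + 1), (z j - z l) := by
      rw [Finset.sum_range_succ, hzero, mul_zero, add_zero]
    calc z j ^ (n + 1)
        = ∑ i ∈ Finset.range (k + 1), newtonCoeff z n i *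
            ∏ l ∈ Finset.range (i + 1), (z j - z l) +
          ∑ i ∈ Finset.range (k + 1), z i * newtonCoeff z n i *
            ∏ l ∈ Finset.range i, (z j - z l) := by
          rw [pow_succ, ih, Finset.sum_mul, ← Finset.sum_add_distrib]
          refine Finset.sum_congr rfl fun i _ => ?_
          rw [Finset.prod_range_succ]
          ring
      _ = _ := by
          rw [hshift, Finset.sum_range_succ' _ k, Finset.sum_range_succ' _ k, ← add_assoc,
            ← Finset.sum_add_distrib]
          simp only [newtonCoeff, add_mul]

open Polynomial in
lemma norm_coeff_prod_X_sub_C_le {z : ℕ → ℂ} (hz : ∀ i, ‖z i‖ ≤ 1) (i n : ℕ) :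
    ‖(∏ l ∈ Finset.range i, (X - C (z l))).coeff n‖ ≤ 2 ^ i := by
  induction i generalizing n with
  | zero =>
    rw [Finset.prod_range_zero, coeff_one]
    split_ifs <;> simp
  | succ i ih =>
    rw [Finset.prod_range_succ, mul_sub, coeff_sub, coeff_mul_C, pow_succ, mul_two]
    refine (norm_sub_le _ _).trans (add_le_add ?_ ?_)
    · cases n with
      | zero => simp
      | succ n => rw [coeff_mul_X]; exact ih n
    · rw [norm_mul]
      exact (mul_le_of_le_one_right (norm_nonneg _) (hz i)).trans (ih n)

/-- Pigeonhole principle for subset sums of bounded complex vectors. -/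
lemma exists_subset_sums_close (u : ℕ → ℕ → ℂ) (s : Finset ℕ) (k B q : ℕ) (hq : 0 < q)
    (hu : ∀ n ∈ s, ∀ i < k, ‖u n i‖ ≤ B)
    (hcard : (2 * (q * (s.card * B)) + 1) ^ (2 * k) < 2 ^ s.card) :
    ∃ S ⊆ s, ∃ T ⊆ s, S ≠ T ∧
      ∀ i < k, ‖∑ n ∈ S, u n i - ∑ n ∈ T, u n i‖ ≤ 2 / q := by
  have hq' : (0 : ℝ) < q := by exact_mod_cast hq
  set M : ℕ := q * (s.card * B) with hM
  set I : Finset ℤ := Finset.Icc (-(M : ℤ)) M with hI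
  let F : Finset ℕ → Fin k → ℤ × ℤ := fun S i =>
    (⌊q * (∑ n ∈ S, u n i).re⌋, ⌊q * (∑ n ∈ S, u n i).im⌋)
  have hmem : ∀ x : ℝ, |x| ≤ s.card * B → ⌊q * x⌋ ∈ I := fun x hx => by
    have hb := abs_le.1 hx
    rw [hI, Finset.mem_Icc]
    constructor
    · rw [Int.le_floor, hM]
      push_cast
      nlinarith
    · have : (⌊q * x⌋ : ℝ) ≤ M := (Int.floor_le _).trans (by rw [hM]; push_cast; nlinarith)
      exact_mod_cast this
  have hnorm : ∀ S ⊆ s, ∀ i < k, ‖∑ n ∈ S, u n i‖ ≤ s.card * B := fun S hS i hi => by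
    refine (norm_sum_le_of_le S fun n hn => hu n (hS hn) i hi).trans ?_
    rw [Finset.sum_const, nsmul_eq_mul]
    gcongr
  obtain ⟨S, hS, T, hT, hne, heq⟩ := Finset.exists_ne_map_eq_of_card_lt_of_maps_to
    (s := s.powerset) (t := Fintype.piFinset fun _ : Fin k => I ×ˢ I) (f := F)
    (by
      have hIcard : I.card = 2 * M + 1 := by rw [hI, Int.card_Icc]; omega
      simpa [Fintype.card_piFinset, hIcard, ← pow_two, ← pow_mul] using hcard)
    (by
      intro S hS
      rw [Finset.mem_coe, Finset.mem_powerset] at hS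
      rw [Finset.mem_coe, Fintype.mem_piFinset]
      intro i
      have h := hnorm S hS i i.2
      exact Finset.mem_product.2 ⟨hmem _ ((Complex.abs_re_le_norm _).trans h),
        hmem _ ((Complex.abs_im_le_norm _).trans h)⟩)
  rw [Finset.mem_powerset] at hS hT
  refine ⟨S, hS, T, hT, hne, fun i hi => ?_⟩
  have hi' := Prod.ext_iff.1 (congrFun heq ⟨i, hi⟩)
  have hclose : ∀ x y : ℝ, ⌊q * x⌋ = ⌊q * y⌋ → |x - y| ≤ 1 / q := fun x y h => by
    have := (Int.abs_sub_lt_one_of_floor_eq_floor h).le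
    rwa [← mul_sub, abs_mul, abs_of_pos hq', ← le_div_iff₀' hq'] at this
  refine (Complex.norm_le_abs_re_add_abs_im _).trans ?_
  rw [Complex.sub_re, Complex.sub_im]
  have h1 := hclose _ _ hi'.1
  have h2 := hclose _ _ hi'.2
  calc _ ≤ (1 : ℝ) / q + 1 / q := add_le_add h1 h2
    _ = 2 / q := by ring

open Polynomial in
/-- Numbers in the closed unit disc are annihilated by a monic polynomial with bounded
coefficients and controlled degree. -/
lemma exists_pow_eq_sum_bounded {z : ℕ → ℂ} (hz : ∀ i, ‖z i‖ ≤ 1) {k N : ℕ}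
    (hk : 0 < k) (hN : (2 * (2 ^ k * (N * (k + N) ^ k)) + 1) ^ (2 * k) < 2 ^ N) :
    ∃ m ≤ k + N, ∃ β : ℕ → ℂ, (∀ n, ‖β n‖ ≤ 2) ∧
      ∀ j < k, z j ^ m = ∑ n ∈ Finset.range m, β n * z j ^ n := by
  classical
  obtain ⟨S, hS, T, hT, hne, hST⟩ := exists_subset_sums_close (newtonCoeff z)
    (Finset.Ico k (k + N)) k ((k + N) ^ k) (2 ^ k) (by positivity)
    (by
      intro n hn i hi
      rw [Finset.mem_Ico] at hn
      refine (norm_newtonCoeff_le hz n i).trans ?_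
      have h : n.choose i ≤ (k + N) ^ k :=
        (Nat.choose_le_pow n i).trans <|
          (Nat.pow_le_pow_left hn.2.le i).trans (Nat.pow_le_pow_right (by omega) hi.le)
      exact_mod_cast h)
    (by simpa using hN)
  set δ : ℕ → ℂ := fun i => ∑ n ∈ S, newtonCoeff z n i - ∑ n ∈ T, newtonCoeff z n i with hδ
  set ε : ℕ → ℂ := fun n => (if n ∈ S then 1 else 0) - (if n ∈ T then 1 else 0) with hε
  set R : ℂ[X] := ∑ i ∈ Finset.range k, C (δ i) * ∏ l ∈ Finset.range i, (X - C (z l)) with hR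
  have hεnorm : ∀ n, ‖ε n‖ ≤ 1 := fun n => by
    simp only [hε]; split_ifs <;> simp
  have hRcoeff : ∀ n, ‖R.coeff n‖ ≤ 2 := fun n => by
    rw [hR, finsetSum_coeff]
    refine (norm_sum_le_of_le (Finset.range k) (n := fun i => (2 / 2 ^ k : ℝ) * 2 ^ i)
      fun i hi => ?_).trans ?_
    · rw [coeff_C_mul, norm_mul]
      gcongr
      · simpa using hST i (Finset.mem_range.1 hi)
      · exact norm_coeff_prod_X_sub_C_le hz i n
    · rw [← Finset.mul_sum, geom_sum_eq (by norm_num), div_mul_eq_mul_div,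
        div_le_iff₀ (by positivity)]
      linarith [show (0 : ℝ) < 2 ^ k by positivity]
  have hRdeg : R.natDegree < k := by
    refine lt_of_le_of_lt (natDegree_sum_le_of_forall_le (n := k - 1) _ _ fun i hi => ?_)
      (by omega)
    refine natDegree_C_mul_le _ _ |>.trans ?_
    rw [natDegree_prod_of_monic _ _ fun l _ => monic_X_sub_C _]
    simpa using Nat.le_sub_one_of_lt (Finset.mem_range.1 hi)
  have heval : ∀ j < k, R.eval (z j) = ∑ n ∈ Finset.range (k + N), ε n * z j ^ n := fun j hj => by
    have hsum : ∀ U ⊆ Finset.Ico k (k + N),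
        ∑ n ∈ Finset.range (k + N), (if n ∈ U then (1 : ℂ) else 0) * z j ^ n =
          ∑ i ∈ Finset.range k, (∑ n ∈ U, newtonCoeff z n i) *
            ∏ l ∈ Finset.range i, (z j - z l) := fun U hU => by
      have hU' : U ⊆ Finset.range (k + N) := fun n hn =>
        Finset.mem_range.2 (Finset.mem_Ico.1 (hU hn)).2
      simp only [ite_mul, one_mul, zero_mul, Finset.sum_ite_mem, Finset.inter_eq_right.2 hU',
        Finset.sum_mul]
      rw [Finset.sum_comm]
      exact Finset.sum_congr rfl fun n _ => pow_eq_sum_newtonCoeff z hj n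
    simp only [hε, sub_mul, Finset.sum_sub_distrib]
    rw [hsum S hS, hsum T hT, ← Finset.sum_sub_distrib, hR, eval_finsetSum]
    refine Finset.sum_congr rfl fun i _ => ?_
    simp only [hδ, eval_mul, eval_prod, eval_sub, eval_X, eval_C, sub_mul]
  have hDne : (symmDiff S T).Nonempty := by
    rw [Finset.nonempty_iff_ne_empty, ← Finset.bot_eq_empty, Ne, symmDiff_eq_bot]
    exact hne
  set m := (symmDiff S T).max' hDne with hm
  have hmem : m ∈ symmDiff S T := Finset.max'_mem _ _
  have hm_mem : m ∈ Finset.Ico k (k + N) := by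
    rcases Finset.mem_symmDiff.1 hmem with h | h
    exacts [hS h.1, hT h.1]
  rw [Finset.mem_Ico] at hm_mem
  have hεm : ε m * ε m = 1 := by
    rcases Finset.mem_symmDiff.1 hmem with h | h <;> simp [hε, h.1, h.2]
  have hεgt : ∀ n, m < n → ε n = 0 := fun n hn => by
    have hnot : n ∉ symmDiff S T := fun h => absurd (Finset.le_max' _ n h) (by omega)
    rw [Finset.mem_symmDiff] at hnot
    by_cases h1 : n ∈ S <;> by_cases h2 : n ∈ T <;> simp_all
  have hεlt : ∀ n, n < k → ε n = 0 := fun n hn => by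
    have h1 : n ∉ S := fun h => by have := Finset.mem_Ico.1 (hS h); omega
    have h2 : n ∉ T := fun h => by have := Finset.mem_Ico.1 (hT h); omega
    simp [hε, h1, h2]
  refine ⟨m, hm_mem.2.le, fun n => ε m * (R.coeff n - ε n), fun n => ?_, fun j hj => ?_⟩
  · rw [norm_mul]
    refine (mul_le_of_le_one_left (norm_nonneg _) (hεnorm m)).trans ?_
    rcases lt_or_ge n k with hn | hn
    · rw [hεlt n hn, sub_zero]
      exact hRcoeff n
    · rw [coeff_eq_zero_of_natDegree_lt (hRdeg.trans_le hn), zero_sub, norm_neg]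
      exact (hεnorm n).trans one_le_two
  · have h := heval j hj
    rw [eval_eq_sum_range' (hRdeg.trans_le hm_mem.1),
      ← Finset.sum_subset (Finset.range_subset_range.2 (Nat.succ_le_of_lt hm_mem.2))
        (fun n _ hn => by rw [hεgt n (by simpa using hn), zero_mul]),
      Finset.sum_range_succ] at h
    simp only [mul_assoc, sub_mul, ← Finset.mul_sum, Finset.sum_sub_distrib]
    rw [h, add_sub_cancel_left, ← mul_assoc, hεm, one_mul]

/-- The choice of parameters making the pigeonhole count succeed. -/
lemma pigeonhole_count {k : ℕ} (hk : 2 ≤ k) :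
    (2 * (2 ^ k * ((128 * k ^ 2 * Nat.log 2 k) *
      (k + 128 * k ^ 2 * Nat.log 2 k) ^ k)) + 1) ^ (2 * k) <
        2 ^ (128 * k ^ 2 * Nat.log 2 k) := by
  set L := Nat.log 2 k with hL
  have hL1 : 1 ≤ L := Nat.log_pos one_lt_two hk
  have hkL : k ≤ 2 ^ (2 * L) :=
    (Nat.lt_pow_succ_log_self one_lt_two k).le.trans (Nat.pow_le_pow_right two_pos (by omega))
  set N := 128 * k ^ 2 * L with hN
  set D := k + N with hD
  have hD8 : 8 ≤ D := by nlinarith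
  have hDle : D ≤ 2 ^ (13 * L) := by
    have hk2 : 1 ≤ k ^ 2 := Nat.one_le_pow _ _ (by omega)
    have h1 : D ≤ 256 * (k ^ 2 * L) := by nlinarith
    have h2 : L ≤ 2 ^ L := Nat.lt_two_pow_self.le
    have h3 : 256 ≤ 2 ^ (8 * L) := by
      calc 256 = 2 ^ 8 := by norm_num
        _ ≤ 2 ^ (8 * L) := Nat.pow_le_pow_right two_pos (by omega)
    calc D ≤ 256 * (k ^ 2 * L) := h1
      _ ≤ 2 ^ (8 * L) * ((2 ^ (2 * L)) ^ 2 * 2 ^ L) := by gcongr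
      _ = 2 ^ (13 * L) := by rw [← pow_mul, ← pow_add, ← pow_add]; congr 1; ring
  have hbase : 2 * (2 ^ k * (N * D ^ k)) + 1 ≤ D ^ (3 * k) := by
    have hND : N ≤ D := by omega
    have h2D : 2 ^ k ≤ D ^ k := Nat.pow_le_pow_left (by omega) k
    have hpos : 1 ≤ D ^ (2 * k + 1) := Nat.one_le_pow _ _ (by omega)
    calc 2 * (2 ^ k * (N * D ^ k)) + 1 ≤ 2 * (D ^ k * (D * D ^ k)) + 1 := by gcongr
      _ = 2 * D ^ (2 * k + 1) + 1 := by ring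
      _ ≤ D ^ (2 * k + 1) * D := by nlinarith
      _ = D ^ (2 * k + 2) := by ring
      _ ≤ D ^ (3 * k) := Nat.pow_le_pow_right (by omega) (by omega)
  calc _ ≤ (D ^ (3 * k)) ^ (2 * k) := Nat.pow_le_pow_left hbase _
    _ ≤ ((2 ^ (13 * L)) ^ (3 * k)) ^ (2 * k) := by gcongr
    _ = 2 ^ (78 * (k ^ 2 * L)) := by rw [← pow_mul, ← pow_mul]; congr 1; ring
    _ < 2 ^ N := by
      refine Nat.pow_lt_pow_right one_lt_two ?_
      have : 0 < k ^ 2 * L := by positivity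
      rw [hN, mul_assoc]
      omega

/-- There are absolute constants `a` and `A` such that for every `k ≥ 2`,
every `k`-Fourier-sparse signal `g`, and every `θ > 0`, there exist `d ≤ a·k²·log k`
and complex coefficients `α₁, …, α_d` with `|α_j| ≤ A` such that
`g x = ∑_{j=1}^d α_j · g (x − j·θ)` for every real `x`. -/
theorem sparse_linear_combination :
    ∃ a A : ℝ, 0 < a ∧ 0 < A ∧
      ∀ (k : ℕ), 2 ≤ k →
        ∀ (v : ℕ → ℂ) (f : ℕ → ℝ) (g : ℝ → ℂ),
          (∀ t : ℝ, g t = ∑ j ∈ Finset.range k,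
              v j * Complex.exp (2 * (Real.pi : ℂ) * Complex.I * (f j : ℂ) * (t : ℂ))) →
          ∀ θ : ℝ, 0 < θ →
            ∃ (d : ℕ) (α : ℕ → ℂ),
              (d : ℝ) ≤ a * (k : ℝ) ^ 2 * Real.log k ∧
              (∀ j, 1 ≤ j → j ≤ d → ‖α j‖ ≤ A) ∧
              (∀ x : ℝ, g x = ∑ j ∈ Finset.Icc 1 d, α j * g (x - (j : ℝ) * θ)) := by
  refine ⟨258, 2, by norm_num, two_pos, fun k hk v f g hg θ _ => ?_⟩
  set z : ℕ → ℂ := fun j => Complex.exp ((2 * π * f j * θ : ℝ) * Complex.I) with hz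
  have hznorm : ∀ j, ‖z j‖ = 1 := fun j => Complex.norm_exp_ofReal_mul_I _
  obtain ⟨m, hm, β, hβ, hrel⟩ := exists_pow_eq_sum_bounded (fun j => (hznorm j).le)
    (by omega) (pigeonhole_count hk)
  refine ⟨m, fun l => β (m - l), ?_, fun l _ _ => hβ _, fun x => ?_⟩
  · have hlog : (Nat.log 2 k : ℝ) ≤ 2 * Real.log k := by
      have h1 : (2 : ℝ) ^ Nat.log 2 k ≤ k := by
        exact_mod_cast Nat.pow_log_le_self 2 (by omega)
      have h2 := Real.log_le_log (by positivity) h1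
      rw [Real.log_pow] at h2
      have := Real.log_two_gt_d9
      nlinarith [(Nat.log 2 k).cast_nonneg (α := ℝ)]
    have hL1 : 1 ≤ Nat.log 2 k := Nat.log_pos one_lt_two hk
    have h3 : m ≤ 129 * k ^ 2 * Nat.log 2 k := by nlinarith [Nat.mul_le_mul hk hL1]
    have h4 : (m : ℝ) ≤ 129 * (k : ℝ) ^ 2 * Nat.log 2 k := by exact_mod_cast h3
    calc (m : ℝ) ≤ 129 * (k : ℝ) ^ 2 * Nat.log 2 k := h4
      _ ≤ 129 * (k : ℝ) ^ 2 * (2 * Real.log k) := by gcongr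
      _ = 258 * (k : ℝ) ^ 2 * Real.log k := by ring
  · have hshift : ∀ j l : ℕ, Complex.exp (2 * (π : ℂ) * Complex.I * f j * x) =
        Complex.exp (2 * (π : ℂ) * Complex.I * f j * ((x - l * θ : ℝ) : ℂ)) * z j ^ l :=
      fun j l => by
        rw [hz, ← Complex.exp_nat_mul, ← Complex.exp_add]
        congr 1
        push_cast
        ring
    have hterm : ∀ j < k, Complex.exp (2 * (π : ℂ) * Complex.I * f j * x) =
        ∑ l ∈ Finset.Icc 1 m, β (m - l) *
          Complex.exp (2 * (π : ℂ) * Complex.I * f j * ((x - l * θ : ℝ) : ℂ)) := fun j hj => by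
      have hz0 : z j ≠ 0 := Complex.exp_ne_zero _
      refine mul_right_cancel₀ (pow_ne_zero m hz0) ?_
      rw [hrel j hj, Finset.mul_sum, ← hrel j hj, Finset.sum_mul]
      refine Finset.sum_bij' (fun n _ => m - n) (fun l _ => m - l) ?_ ?_ ?_ ?_ ?_
      · intro n hn; simp at hn ⊢; omega
      · intro l hl; simp at hl ⊢; omega
      · intro n hn; simp at hn ⊢; omega
      · intro l hl; simp at hl ⊢; omega
      · intro n hn
        rw [Finset.mem_range] at hn
        rw [hshift j (m - n), Nat.sub_sub_self hn.le]
        conv_rhs => rw [← Nat.sub_add_cancel hn.le, pow_add]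
        rw [Nat.sub_add_cancel hn.le]
        ring
    simp only [hg, Finset.mul_sum]
    rw [Finset.sum_comm]
    refine Finset.sum_congr rfl fun j hj => ?_
    rw [hterm j (Finset.mem_range.1 hj), Finset.mul_sum]
    exact Finset.sum_congr rfl fun l _ => by ring
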